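/- arXiv:1903.07597 — 10 statements merged into one kernel-verified Lean document; each statement's English description precedes it below -/
import Mathlib

section
/- Let W₁, W₁', W₂, W₂', S be random variables taking values in finite types on a common probability space. If H(W₁ | W₁', S) = 0 and H(W₂ | W₂', S) = 0 (each user can decode its desired message with zero error from the broadcast S and its own side information), then H(S) ≥ H(W₁ | W₁') + H(W₂ | W₁, W₁', W₂'). -/
open MeasureTheory Real

/-- Shannon entropy (natural log) of a random variable `X` taking values in a
finite type, on a probability space `(Ω, μ)`:
`H(X) = -∑ₓ P(X = x) log P(X = x)`. -/
noncomputable def entropy {Ω A : Type*} [MeasurableSpace Ω] [Fintype A]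
    (μ : Measure Ω) (X : Ω → A) : ℝ :=
  ∑ x : A, Real.negMulLog ((μ (X ⁻¹' {x})).toReal)

/-- Conditional entropy `H(X | Y) = H(X, Y) - H(Y)`. -/
noncomputable def condEntropy {Ω A B : Type*} [MeasurableSpace Ω] [Fintype A] [Fintype B]
    (μ : Measure Ω) (X : Ω → A) (Y : Ω → B) : ℝ :=
  entropy μ (fun ω => (X ω, Y ω)) - entropy μ Y

/-- Submodularity of entropy for a nonnegative matrix with given row, column and total sums. -/
lemma sum_negMulLog_add_negMulLog_sum_le {A B : Type*} [Fintype A] [Fintype B]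
    (p : A → B → ℝ) (hp : ∀ x y, 0 ≤ p x y) :
    (∑ x, ∑ y, negMulLog (p x y)) + negMulLog (∑ x, ∑ y, p x y) ≤
      (∑ x, negMulLog (∑ y, p x y)) + ∑ y, negMulLog (∑ x, p x y) := by
  set r : A → ℝ := fun x => ∑ y, p x y with hr
  set c : B → ℝ := fun y => ∑ x, p x y with hc
  set t : ℝ := ∑ x, ∑ y, p x y with ht
  have hr0 : ∀ x, 0 ≤ r x := fun x => Finset.sum_nonneg fun y _ => hp x y
  have hc0 : ∀ y, 0 ≤ c y := fun y => Finset.sum_nonneg fun x _ => hp x y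
  have hpr : ∀ x y, p x y ≤ r x := fun x y =>
    Finset.single_le_sum (f := fun y => p x y) (fun y _ => hp x y) (Finset.mem_univ y)
  have hpc : ∀ x y, p x y ≤ c y := fun x y =>
    Finset.single_le_sum (f := fun x => p x y) (fun x _ => hp x y) (Finset.mem_univ x)
  have hrt : ∀ x, r x ≤ t := fun x =>
    Finset.single_le_sum (f := r) (fun x _ => hr0 x) (Finset.mem_univ x)
  have ht0 : 0 ≤ t := Finset.sum_nonneg fun x _ => hr0 x
  have hct : ∑ y, c y = t := Finset.sum_comm
  have key : ∀ x y, p x y - r x * c y / t ≤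
      -(p x y * log (r x)) - p x y * log (c y) - negMulLog (p x y) + p x y * log t := by
    intro x y
    rcases (hp x y).eq_or_lt with h | h
    · have : 0 ≤ r x * c y / t := div_nonneg (mul_nonneg (hr0 x) (hc0 y)) ht0
      simpa [← h] using this
    · have h1 : 0 < r x := h.trans_le (hpr x y)
      have h2 : 0 < c y := h.trans_le (hpc x y)
      have h3 : 0 < t := h1.trans_le (hrt x)
      have hlog := one_sub_inv_le_log_of_pos (x := p x y * t / (r x * c y)) (by positivity)
      rw [log_div (by positivity) (by positivity), log_mul h.ne' h3.ne',
        log_mul h1.ne' h2.ne'] at hlog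
      have hmul := mul_le_mul_of_nonneg_left hlog h.le
      have heq : p x y * (1 - (p x y * t / (r x * c y))⁻¹) = p x y - r x * c y / t := by
        field_simp
      rw [heq] at hmul
      rw [negMulLog]
      linarith
  have hsum := Finset.sum_le_sum fun x (_ : x ∈ Finset.univ) =>
    Finset.sum_le_sum fun y (_ : y ∈ Finset.univ) => key x y
  have hprod : ∑ x, ∑ y, r x * c y / t = t := by
    have : ∀ x, ∑ y, r x * c y / t = r x * (t / t) := fun x => by
      rw [← Finset.sum_div, ← Finset.mul_sum, hct, mul_div_assoc]
    rw [Finset.sum_congr rfl fun x _ => this x, ← Finset.sum_mul]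
    exact (mul_div_assoc t t t).symm.trans (mul_self_div_self t)
  have hrow : ∑ x, ∑ y, p x y * log (r x) = -∑ x, negMulLog (r x) := by
    simp only [negMulLog, neg_mul, Finset.sum_neg_distrib, neg_neg, ← Finset.sum_mul, hr]
  have hcol : ∑ x, ∑ y, p x y * log (c y) = -∑ y, negMulLog (c y) := by
    rw [Finset.sum_comm]
    simp only [negMulLog, neg_mul, Finset.sum_neg_distrib, neg_neg, ← Finset.sum_mul, hc]
  have htot : ∑ x, ∑ y, p x y * log t = -negMulLog t := by
    simp only [negMulLog, neg_mul, neg_neg, ← Finset.sum_mul, ht]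
  simp only [Finset.sum_add_distrib, Finset.sum_sub_distrib, Finset.sum_neg_distrib] at hsum
  rw [hprod, hrow, hcol, htot, ← ht] at hsum
  linarith

lemma negMulLog_sum_le {ι : Type*} (s : Finset ι) (p : ι → ℝ) (hp : ∀ i ∈ s, 0 ≤ p i) :
    negMulLog (∑ i ∈ s, p i) ≤ ∑ i ∈ s, negMulLog (p i) := by
  rw [negMulLog, ← Finset.sum_neg_distrib, Finset.sum_mul]
  refine Finset.sum_le_sum fun i hi => ?_
  rw [negMulLog]
  rcases (hp i hi).eq_or_lt with h | h
  · simp [← h]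
  · have := mul_le_mul_of_nonneg_left (log_le_log h (Finset.single_le_sum hp hi)) h.le
    linarith

lemma measureReal_eq_sum_inter_preimage {Ω B : Type*} [MeasurableSpace Ω] [Fintype B]
    [MeasurableSpace B] [MeasurableSingletonClass B] (μ : Measure Ω) [IsFiniteMeasure μ]
    {Y : Ω → B} (hY : Measurable Y) (s : Set Ω) :
    μ.real s = ∑ y, μ.real (Y ⁻¹' {y} ∩ s) := by
  have h := sum_measureReal_preimage_singleton (μ := μ.restrict s) (f := Y) Finset.univ
    fun y _ => hY (measurableSet_singleton y)
  simp only [measureReal_restrict_apply (hY (measurableSet_singleton _))] at h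
  simp [h]

/-- The entropy of a function of `Y` is at most the entropy of `Y`. -/
lemma entropy_comp_le {Ω A B : Type*} [MeasurableSpace Ω] [Fintype A] [Fintype B]
    [MeasurableSpace B] [MeasurableSingletonClass B] (μ : Measure Ω) [IsFiniteMeasure μ]
    {Y : Ω → B} (hY : Measurable Y) (f : B → A) :
    entropy μ (fun ω => f (Y ω)) ≤ entropy μ Y := by
  classical
  unfold entropy
  rw [← Finset.sum_fiberwise Finset.univ f]
  refine Finset.sum_le_sum fun x _ => ?_
  have h : (μ ((fun ω => f (Y ω)) ⁻¹' {x})).toReal =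
      ∑ y with f y = x, (μ (Y ⁻¹' {y})).toReal := by
    refine Eq.trans ?_ (sum_measureReal_preimage_singleton (μ := μ) _
      fun y _ => hY (measurableSet_singleton y)).symm
    rw [Measure.real]
    congr 2
    ext ω
    simp
  rw [h]
  exact negMulLog_sum_le _ _ fun _ _ => ENNReal.toReal_nonneg

/-- Submodularity of entropy: `H(X, Y, Z) + H(Z) ≤ H(X, Z) + H(Y, Z)`. -/
lemma entropy_submodular {Ω A B C : Type*} [MeasurableSpace Ω]
    [Fintype A] [Fintype B] [Fintype C]
    [MeasurableSpace A] [MeasurableSingletonClass A]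
    [MeasurableSpace B] [MeasurableSingletonClass B]
    (μ : Measure Ω) [IsFiniteMeasure μ]
    {X : Ω → A} {Y : Ω → B} (hX : Measurable X) (hY : Measurable Y) (Z : Ω → C) :
    entropy μ (fun ω => (X ω, Y ω, Z ω)) + entropy μ Z ≤
      entropy μ (fun ω => (X ω, Z ω)) + entropy μ (fun ω => (Y ω, Z ω)) := by
  let p : C → A → B → ℝ := fun z x y => μ.real (Y ⁻¹' {y} ∩ (X ⁻¹' {x} ∩ Z ⁻¹' {z}))
  have hXYZ : entropy μ (fun ω => (X ω, Y ω, Z ω)) =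
      ∑ z, ∑ x, ∑ y, negMulLog (p z x y) := by
    simp only [entropy, Fintype.sum_prod_type]
    rw [Finset.sum_congr rfl fun x _ => Finset.sum_comm, Finset.sum_comm]
    refine Finset.sum_congr rfl fun z _ => Finset.sum_congr rfl fun x _ =>
      Finset.sum_congr rfl fun y _ => congrArg negMulLog ?_
    simp only [p, Measure.real]
    congr 2
    ext ω
    simp [and_left_comm]
  have hZ : entropy μ Z = ∑ z, negMulLog (∑ x, ∑ y, p z x y) := by
    refine Finset.sum_congr rfl fun z _ => congrArg negMulLog ?_
    refine (measureReal_eq_sum_inter_preimage μ hX _).trans ?_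
    exact Finset.sum_congr rfl fun x _ => measureReal_eq_sum_inter_preimage μ hY _
  have hXZ : entropy μ (fun ω => (X ω, Z ω)) = ∑ z, ∑ x, negMulLog (∑ y, p z x y) := by
    rw [entropy, Fintype.sum_prod_type_right]
    refine Finset.sum_congr rfl fun z _ => Finset.sum_congr rfl fun x _ => congrArg negMulLog ?_
    rw [← measureReal_eq_sum_inter_preimage μ hY, Measure.real]
    congr 2
    ext ω
    simp
  have hYZ : entropy μ (fun ω => (Y ω, Z ω)) = ∑ z, ∑ y, negMulLog (∑ x, p z x y) := by
    rw [entropy, Fintype.sum_prod_type_right]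
    refine Finset.sum_congr rfl fun z _ => Finset.sum_congr rfl fun y _ => congrArg negMulLog ?_
    simp only [p, Set.inter_left_comm (Y ⁻¹' {y})]
    rw [← measureReal_eq_sum_inter_preimage μ hX, Measure.real]
    congr 2
    ext ω
    simp
  rw [hXYZ, hZ, hXZ, hYZ, ← Finset.sum_add_distrib, ← Finset.sum_add_distrib]
  exact Finset.sum_le_sum fun z _ =>
    sum_negMulLog_add_negMulLog_sum_le (p z) fun _ _ => measureReal_nonneg

/-- Subadditivity of entropy. -/
lemma entropy_prod_le {Ω A B : Type*} [MeasurableSpace Ω] [Fintype A] [Fintype B]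
    [MeasurableSpace A] [MeasurableSingletonClass A]
    [MeasurableSpace B] [MeasurableSingletonClass B]
    (μ : Measure Ω) [IsProbabilityMeasure μ]
    {X : Ω → A} {Y : Ω → B} (hX : Measurable X) (hY : Measurable Y) :
    entropy μ (fun ω => (X ω, Y ω)) ≤ entropy μ X + entropy μ Y := by
  have hsub := entropy_submodular μ hX hY (fun _ => ())
  have hunit : entropy μ (fun _ : Ω => ()) = 0 := by simp [entropy]
  have h₁ := entropy_comp_le μ (hX.prodMk (hY.prodMk (measurable_const (a := ()))))
    fun v => (v.1, v.2.1)
  have h₂ := entropy_comp_le μ hX fun x => (x, ())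
  have h₃ := entropy_comp_le μ hY fun y => (y, ())
  linarith

/-- If `H(W₁ | W₁', S) = 0` and `H(W₂ | W₂', S) = 0`, then
`H(S) ≥ H(W₁ | W₁') + H(W₂ | W₁, W₁', W₂')`. -/
theorem computation_broadcast_bound
    {Ω A₁ B₁ A₂ B₂ T : Type*} [MeasurableSpace Ω]
    [Fintype A₁] [Fintype B₁] [Fintype A₂] [Fintype B₂] [Fintype T]
    [MeasurableSpace A₁] [MeasurableSingletonClass A₁]
    [MeasurableSpace B₁] [MeasurableSingletonClass B₁]
    [MeasurableSpace A₂] [MeasurableSingletonClass A₂]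
    [MeasurableSpace B₂] [MeasurableSingletonClass B₂]
    [MeasurableSpace T] [MeasurableSingletonClass T]
    (μ : Measure Ω) [IsProbabilityMeasure μ]
    (W₁ : Ω → A₁) (W₁' : Ω → B₁) (W₂ : Ω → A₂) (W₂' : Ω → B₂) (S : Ω → T)
    (hW₁ : Measurable W₁) (hW₁' : Measurable W₁') (hW₂ : Measurable W₂)
    (hW₂' : Measurable W₂') (hS : Measurable S)
    (hdec1 : condEntropy μ W₁ (fun ω => (W₁' ω, S ω)) = 0)
    (hdec2 : condEntropy μ W₂ (fun ω => (W₂' ω, S ω)) = 0) :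
    entropy μ S ≥ condEntropy μ W₁ W₁' +
      condEntropy μ W₂ (fun ω => (W₁ ω, W₁' ω, W₂' ω)) := by
  unfold condEntropy at *
  have hbs := entropy_prod_le μ hW₁' hS
  have hsd := entropy_submodular μ hS hW₂' (fun ω => (W₁ ω, W₁' ω))
  have hdec := entropy_submodular μ hW₂ (hW₁.prodMk hW₁') (fun ω => (W₂' ω, S ω))
  have hall := hW₂.prodMk ((hW₁.prodMk hW₁').prodMk (hW₂'.prodMk hS))
  have hcabd := entropy_comp_le μ hall fun v => (v.1, v.2.1.1, v.2.1.2, v.2.2.1)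
  have habds := entropy_comp_le μ (hS.prodMk (hW₂'.prodMk (hW₁.prodMk hW₁')))
    fun v => ((v.2.2.1, v.2.2.2), v.2.1, v.1)
  have hsab := entropy_comp_le μ (hW₁.prodMk (hW₁'.prodMk hS)) fun v => (v.2.2, v.1, v.2.1)
  have hdab := entropy_comp_le μ (hW₁.prodMk (hW₁'.prodMk hW₂')) fun v => (v.2.2, v.1, v.2.1)
  linarith
end

section
/- Let W₁, W₁', W₂, W₂', S be random variables taking values in finite types on a common probability space. If H(W₂ | W₂', S) = 0, then H(S, W₁ | W₁') ≥ H(W₁ | W₁') + H(W₂ | W₁, W₁', W₂') + I(S; W₂' | W₁, W₁'). -/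
open MeasureTheory Real

/-- Conditional mutual information `I(X; Y | Z) = H(X|Z) + H(Y|Z) - H(X,Y|Z)`. -/
noncomputable def condMutualInfo {Ω A B C : Type*} [MeasurableSpace Ω]
    [Fintype A] [Fintype B] [Fintype C]
    (μ : Measure Ω) (X : Ω → A) (Y : Ω → B) (Z : Ω → C) : ℝ :=
  condEntropy μ X Z + condEntropy μ Y Z - condEntropy μ (fun ω => (X ω, Y ω)) Z

/-- Entropy is invariant under relabelling the values by an injective map. -/
theorem entropy_comp_injective {Ω A B : Type*} [MeasurableSpace Ω] [Fintype A] [Fintype B]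
    (μ : Measure Ω) (X : Ω → A) {f : A → B} (hf : Function.Injective f) :
    entropy μ (fun ω => f (X ω)) = entropy μ X := by
  symm
  refine Fintype.sum_of_injective f hf _ _ (fun b hb => ?_) (fun a => ?_)
  · have : (fun ω => f (X ω)) ⁻¹' {b} = ∅ :=
      Set.eq_empty_of_forall_notMem fun ω hω => hb ⟨X ω, hω⟩
    simp [this]
  · have : (fun ω => f (X ω)) ⁻¹' {f a} = X ⁻¹' {a} := by
      ext ω
      simp [hf.eq_iff]
    rw [this]

/-- The marginal law is obtained by summing the joint law over the other variable. -/
theorem sum_measureReal_preimage_pair {Ω A B : Type*} [MeasurableSpace Ω] [Fintype A]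
    [MeasurableSpace A] [MeasurableSingletonClass A]
    (μ : Measure Ω) [IsFiniteMeasure μ] {X : Ω → A} (hX : Measurable X) (Y : Ω → B) (y : B) :
    ∑ x, μ.real ((fun ω => (X ω, Y ω)) ⁻¹' {(x, y)}) = μ.real (Y ⁻¹' {y}) := by
  have h := sum_measureReal_preimage_singleton (μ := μ.restrict (Y ⁻¹' {y})) (f := X) Finset.univ
    (fun x _ => hX (measurableSet_singleton x))
  simp only [Finset.coe_univ, Set.preimage_univ, measureReal_restrict_apply_univ] at h
  rw [← h]
  refine Finset.sum_congr rfl fun x _ => ?_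
  rw [measureReal_restrict_apply (hX (measurableSet_singleton x))]
  congr 1
  ext ω
  simp

/-- Conditional entropy as the expected value of `log P(Y = y) - log P(X = x, Y = y)`. -/
theorem condEntropy_eq_sum {Ω A B : Type*} [MeasurableSpace Ω] [Fintype A] [Fintype B]
    [MeasurableSpace A] [MeasurableSingletonClass A]
    (μ : Measure Ω) [IsFiniteMeasure μ] {X : Ω → A} (hX : Measurable X) (Y : Ω → B) :
    condEntropy μ X Y = ∑ p : A × B, μ.real ((fun ω => (X ω, Y ω)) ⁻¹' {p}) *
      (log (μ.real (Y ⁻¹' {p.2})) - log (μ.real ((fun ω => (X ω, Y ω)) ⁻¹' {p}))) := by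
  have hY : entropy μ Y = -∑ p : A × B, μ.real ((fun ω => (X ω, Y ω)) ⁻¹' {p}) *
      log (μ.real (Y ⁻¹' {p.2})) := by
    rw [Fintype.sum_prod_type_right, ← Finset.sum_neg_distrib]
    refine Finset.sum_congr rfl fun y _ => ?_
    dsimp only
    rw [← Finset.sum_mul, sum_measureReal_preimage_pair μ hX, negMulLog, neg_mul]
    rfl
  simp only [mul_sub, Finset.sum_sub_distrib]
  rw [condEntropy, hY, entropy]
  simp only [negMulLog, neg_mul, Finset.sum_neg_distrib, Measure.real]
  ring

theorem measureReal_preimage_pair_le {Ω A B : Type*} [MeasurableSpace Ω]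
    (μ : Measure Ω) [IsFiniteMeasure μ] (X : Ω → A) (Y : Ω → B) (p : A × B) :
    μ.real ((fun ω => (X ω, Y ω)) ⁻¹' {p}) ≤ μ.real (Y ⁻¹' {p.2}) :=
  measureReal_mono fun _ hω => congrArg Prod.snd hω

theorem measureReal_mul_log_sub_log_nonneg {Ω A B : Type*} [MeasurableSpace Ω]
    (μ : Measure Ω) [IsFiniteMeasure μ] (X : Ω → A) (Y : Ω → B) (p : A × B) :
    0 ≤ μ.real ((fun ω => (X ω, Y ω)) ⁻¹' {p}) *
      (log (μ.real (Y ⁻¹' {p.2})) - log (μ.real ((fun ω => (X ω, Y ω)) ⁻¹' {p}))) := by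
  have h0 : 0 ≤ μ.real ((fun ω => (X ω, Y ω)) ⁻¹' {p}) := measureReal_nonneg
  rcases h0.eq_or_lt with h | h
  · simp [← h]
  · exact mul_nonneg h0 (sub_nonneg.2 (log_le_log h (measureReal_preimage_pair_le μ X Y p)))

theorem condEntropy_nonneg {Ω A B : Type*} [MeasurableSpace Ω] [Fintype A] [Fintype B]
    [MeasurableSpace A] [MeasurableSingletonClass A]
    (μ : Measure Ω) [IsFiniteMeasure μ] {X : Ω → A} (hX : Measurable X) (Y : Ω → B) :
    0 ≤ condEntropy μ X Y := by
  rw [condEntropy_eq_sum μ hX]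
  exact Finset.sum_nonneg fun p _ => measureReal_mul_log_sub_log_nonneg μ X Y p

/-- If `H(X | Y) = 0`, then every joint value of positive probability has the probability of its
`Y`-component. -/
theorem measureReal_preimage_pair_eq_of_condEntropy_eq_zero {Ω A B : Type*} [MeasurableSpace Ω]
    [Fintype A] [Fintype B] [MeasurableSpace A] [MeasurableSingletonClass A]
    (μ : Measure Ω) [IsFiniteMeasure μ] {X : Ω → A} (hX : Measurable X) {Y : Ω → B}
    (h : condEntropy μ X Y = 0) {p : A × B}
    (hp : μ.real ((fun ω => (X ω, Y ω)) ⁻¹' {p}) ≠ 0) :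
    μ.real ((fun ω => (X ω, Y ω)) ⁻¹' {p}) = μ.real (Y ⁻¹' {p.2}) := by
  rw [condEntropy_eq_sum μ hX, Finset.sum_eq_zero_iff_of_nonneg
    fun p _ => measureReal_mul_log_sub_log_nonneg μ X Y p] at h
  have hlog := sub_eq_zero.1 ((mul_eq_zero.1 (h p (Finset.mem_univ p))).resolve_left hp)
  have hpos := measureReal_nonneg.lt_of_ne' hp
  exact (log_injOn_pos (hpos.trans_le (measureReal_preimage_pair_le μ X Y p)) hpos hlog).symm

/-- If `X` is determined by `Y`, then it is determined by `(Y, Z)`. -/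
theorem condEntropy_pair_eq_zero {Ω A B C : Type*} [MeasurableSpace Ω]
    [Fintype A] [Fintype B] [Fintype C] [MeasurableSpace A] [MeasurableSingletonClass A]
    [MeasurableSpace B] [MeasurableSingletonClass B]
    (μ : Measure Ω) [IsFiniteMeasure μ] {X : Ω → A} (hX : Measurable X) {Y : Ω → B}
    (hY : Measurable Y) (Z : Ω → C) (h : condEntropy μ X Y = 0) :
    condEntropy μ X (fun ω => (Y ω, Z ω)) = 0 := by
  rw [condEntropy_eq_sum μ hX]
  refine Finset.sum_eq_zero fun ⟨x, y, z⟩ _ => ?_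
  by_cases hp : μ.real ((fun ω => (X ω, (Y ω, Z ω))) ⁻¹' {(x, y, z)}) = 0
  · rw [hp, zero_mul]
  have hle : μ.real ((fun ω => (X ω, (Y ω, Z ω))) ⁻¹' {(x, y, z)}) ≤
      μ.real ((fun ω => (X ω, Y ω)) ⁻¹' {(x, y)}) :=
    measureReal_mono fun ω hω => by simp_all
  have hxy := measureReal_preimage_pair_eq_of_condEntropy_eq_zero μ hX h
    (p := (x, y)) ((measureReal_nonneg.lt_of_ne' hp).trans_le hle).ne'
  have hnull : μ.real (Y ⁻¹' {y} \ (fun ω => (X ω, Y ω)) ⁻¹' {(x, y)}) = 0 := by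
    have hsub : (fun ω => (X ω, Y ω)) ⁻¹' {(x, y)} ⊆ Y ⁻¹' {y} :=
      fun ω hω => congrArg Prod.snd hω
    rw [measureReal_sdiff hsub ((hX.prodMk hY) (measurableSet_singleton _)), hxy, sub_self]
  have hge : μ.real ((fun ω => (Y ω, Z ω)) ⁻¹' {(y, z)}) ≤
      μ.real ((fun ω => (X ω, (Y ω, Z ω))) ⁻¹' {(x, y, z)}) +
        μ.real (Y ⁻¹' {y} \ (fun ω => (X ω, Y ω)) ⁻¹' {(x, y)}) := by
    refine (measureReal_mono fun ω hω => ?_).trans (measureReal_union_le _ _)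
    by_cases hx : X ω = x <;> simp_all
  have heq := (measureReal_preimage_pair_le μ X (fun ω => (Y ω, Z ω)) (x, y, z)).antisymm
    (by simpa [hnull] using hge)
  rw [heq, sub_self, mul_zero]

/-- If `H(W₂ | W₂', S) = 0`, then
`H(S, W₁ | W₁') ≥ H(W₁|W₁') + H(W₂ | W₁, W₁', W₂') + I(S; W₂' | W₁, W₁')`. -/
theorem computation_broadcast_key_step
    {Ω A₁ B₁ A₂ B₂ T : Type*} [MeasurableSpace Ω]
    [Fintype A₁] [Fintype B₁] [Fintype A₂] [Fintype B₂] [Fintype T]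
    [MeasurableSpace A₁] [MeasurableSingletonClass A₁]
    [MeasurableSpace B₁] [MeasurableSingletonClass B₁]
    [MeasurableSpace A₂] [MeasurableSingletonClass A₂]
    [MeasurableSpace B₂] [MeasurableSingletonClass B₂]
    [MeasurableSpace T] [MeasurableSingletonClass T]
    (μ : Measure Ω) [IsProbabilityMeasure μ]
    (W₁ : Ω → A₁) (W₁' : Ω → B₁) (W₂ : Ω → A₂) (W₂' : Ω → B₂) (S : Ω → T)
    (hW₁ : Measurable W₁) (hW₁' : Measurable W₁') (hW₂ : Measurable W₂)
    (hW₂' : Measurable W₂') (hS : Measurable S)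
    (hdec2 : condEntropy μ W₂ (fun ω => (W₂' ω, S ω)) = 0) :
    condEntropy μ (fun ω => (S ω, W₁ ω)) W₁' ≥
      condEntropy μ W₁ W₁' + condEntropy μ W₂ (fun ω => (W₁ ω, W₁' ω, W₂' ω)) +
        condMutualInfo μ S W₂' (fun ω => (W₁ ω, W₁' ω)) := by
  have hdet := condEntropy_pair_eq_zero μ hW₂ (hW₂'.prodMk hS) (fun ω => (W₁ ω, W₁' ω)) hdec2
  have hmono := condEntropy_nonneg μ hS (fun ω => (W₂ ω, (W₁ ω, W₁' ω, W₂' ω)))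
  have h₁ := entropy_comp_injective μ (fun ω => ((S ω, W₁ ω), W₁' ω))
    (f := fun p => (p.1.1, (p.1.2, p.2))) (fun p q h => by grind)
  have h₂ := entropy_comp_injective μ (fun ω => (W₁ ω, W₁' ω, W₂' ω))
    (f := fun p => (p.2.2, (p.1, p.2.1))) (fun p q h => by grind)
  have h₃ := entropy_comp_injective μ (fun ω => (S ω, (W₂ ω, (W₁ ω, W₁' ω, W₂' ω))))
    (f := fun p => (p.2.1, ((p.2.2.2.2, p.1), (p.2.2.1, p.2.2.2.1)))) (fun p q h => by grind)
  have h₄ := entropy_comp_injective μ (fun ω => ((S ω, W₂' ω), (W₁ ω, W₁' ω)))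
    (f := fun p => ((p.1.2, p.1.1), p.2)) (fun p q h => by grind)
  simp only [condMutualInfo, condEntropy] at *
  linarith
end

section
/- Let F be a finite field, let the uniform probability measure be placed on Fin m → F, and let A : Matrix (Fin m) (Fin nA) F and B : Matrix (Fin m) (Fin nB) F. Then the random variables x ↦ Matrix.vecMul x A and x ↦ Matrix.vecMul x B are independent (as functions on F^m with the uniform measure) if and only if the column span of A and the column span of B intersect trivially, i.e., range(Matrix.mulVecLin A) ⊓ range(Matrix.mulVecLin B) = ⊥. -/
/-- Two random variables `X`, `Y` (taking values in arbitrary types) defined on a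
sample space carrying a probability mass function `μ` are independent if the joint
probability of every pair of outcome values factorizes. -/
def PMFIndepRV {Ω A B : Type*} (μ : PMF Ω) (X : Ω → A) (Y : Ω → B) : Prop :=
  ∀ (a : A) (b : B),
    μ.toOuterMeasure (X ⁻¹' {a} ∩ Y ⁻¹' {b}) =
      μ.toOuterMeasure (X ⁻¹' {a}) * μ.toOuterMeasure (Y ⁻¹' {b})

/-- Two linear maps on a finite module, viewed as random variables on the uniform probability
space, are independent iff their kernels span the module. -/
theorem pmfIndepRV_uniformOfFintype_iff_ker_sup_ker_eq_top
    {K V W W' : Type*} [Field K] [AddCommGroup V] [Module K V] [Fintype V]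
    [AddCommGroup W] [Module K W] [AddCommGroup W'] [Module K W']
    (f : V →ₗ[K] W) (g : V →ₗ[K] W') :
    PMFIndepRV (PMF.uniformOfFintype V) f g ↔ LinearMap.ker f ⊔ LinearMap.ker g = ⊤ := by
  classical
  have hμ (s : Set V) :
      (PMF.uniformOfFintype V).toOuterMeasure s = (Nat.card s : ENNReal) / Nat.card V := by
    rw [PMF.toOuterMeasure_uniformOfFintype_apply, Nat.card_eq_fintype_card,
      Nat.card_eq_fintype_card]
  have hV : (Nat.card V : ENNReal) ≠ 0 := by simp
  have hV' : (Nat.card V : ENNReal) ≠ ⊤ := ENNReal.natCast_ne_top _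
  have hpos (s : Set V) : (PMF.uniformOfFintype V).toOuterMeasure s ≠ 0 ↔ s.Nonempty := by
    rw [hμ, ENNReal.div_ne_zero, Nat.cast_ne_zero, Nat.card_ne_zero, Set.nonempty_coe_sort]
    exact ⟨fun h => h.1.1, fun h => ⟨⟨h, inferInstance⟩, hV'⟩⟩
  constructor
  · intro h
    refine (Submodule.eq_top_iff').2 fun v => ?_
    have hne : (f ⁻¹' {f v} ∩ g ⁻¹' {0}).Nonempty := by
      rw [← hpos, h]
      exact mul_ne_zero ((hpos _).2 ⟨v, rfl⟩) ((hpos _).2 ⟨0, map_zero g⟩)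
    obtain ⟨x, hx, hx'⟩ := hne
    refine Submodule.mem_sup.2 ⟨v - x, ?_, x, hx', sub_add_cancel v x⟩
    rw [LinearMap.mem_ker, map_sub, sub_eq_zero]
    exact Eq.symm hx
  · intro h a b
    by_cases ha : (f ⁻¹' {a}).Nonempty
    swap
    · rw [Set.not_nonempty_iff_eq_empty.1 ha]
      simp
    by_cases hb : (g ⁻¹' {b}).Nonempty
    swap
    · rw [Set.not_nonempty_iff_eq_empty.1 hb]
      simp
    obtain ⟨u, rfl⟩ := ha
    obtain ⟨w, rfl⟩ := hb
    obtain ⟨k, hk, l, hl, hkl⟩ := Submodule.mem_sup.1 (h ▸ Submodule.mem_top : u - w ∈ _)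
    rw [LinearMap.mem_ker] at hk hl
    obtain ⟨x, hxu, hxw⟩ : ∃ x, f u = f x ∧ g w = g x := by
      refine ⟨w + l, ?_, by simp [hl]⟩
      rw [← sub_eq_zero, ← map_sub, ← sub_sub, ← hkl, add_sub_cancel_right, hk]
    rw [hxu, hxw]
    have htrans (s t : Set V) (hst : ∀ y, y ∈ s ↔ y - x ∈ t) : Nat.card s = Nat.card t :=
      Nat.card_congr ((Equiv.subRight x).subtypeEquiv hst)
    have hf := htrans (f ⁻¹' {f x}) (LinearMap.ker f) (by simp [sub_eq_zero])
    have hg := htrans (g ⁻¹' {g x}) (LinearMap.ker g) (by simp [sub_eq_zero])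
    have hfg := htrans (f ⁻¹' {f x} ∩ g ⁻¹' {g x})
      (LinearMap.ker f ⊓ LinearMap.ker g : Submodule K V) (by simp [sub_eq_zero])
    have hcard : Nat.card (LinearMap.ker f ⊓ LinearMap.ker g : Submodule K V) * Nat.card V =
        Nat.card (LinearMap.ker f) * Nat.card (LinearMap.ker g) := by
      rw [Module.natCard_eq_pow_finrank (K := K) (V := V),
        Module.natCard_eq_pow_finrank (K := K) (V := LinearMap.ker f),
        Module.natCard_eq_pow_finrank (K := K) (V := LinearMap.ker g),
        Module.natCard_eq_pow_finrank (K := K)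
          (V := (LinearMap.ker f ⊓ LinearMap.ker g : Submodule K V)), ← pow_add, ← pow_add,
        ← Submodule.finrank_sup_add_finrank_inf_eq, h, finrank_top, add_comm]
    rw [hμ, hμ, hμ, hf, hg, hfg]
    simp only [SetLike.coe_sort_coe]
    rw [← ENNReal.mul_div_mul_right _ _ hV hV', ← Nat.cast_mul, hcard, Nat.cast_mul,
      div_eq_mul_inv, div_eq_mul_inv, div_eq_mul_inv,
      ENNReal.mul_inv (Or.inl hV) (Or.inl hV'), mul_mul_mul_comm]

theorem Matrix.ker_vecMulLinear_eq_comap_dualAnnihilator {K m n : Type*} [Field K]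
    [Fintype m] [DecidableEq m] [Fintype n] (A : Matrix m n K) :
    LinearMap.ker A.vecMulLinear =
      (LinearMap.range A.mulVecLin).dualAnnihilator.comap
        (dotProductEquiv K m : (m → K) →ₗ[K] Module.Dual K (m → K)) := by
  ext x
  simp only [LinearMap.mem_ker, Matrix.vecMulLinear_apply, Submodule.mem_comap,
    Submodule.mem_dualAnnihilator, LinearMap.mem_range, forall_exists_index,
    forall_apply_eq_imp_iff, Matrix.mulVecLin_apply]
  simp [Matrix.dotProduct_mulVec, dotProduct_eq_zero_iff]

theorem Matrix.ker_vecMulLinear_sup_eq_top_iff {K m n n' : Type*} [Field K]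
    [Fintype m] [Fintype n] [Fintype n'] (A : Matrix m n K) (B : Matrix m n' K) :
    LinearMap.ker A.vecMulLinear ⊔ LinearMap.ker B.vecMulLinear = ⊤ ↔
      LinearMap.range A.mulVecLin ⊓ LinearMap.range B.mulVecLin = ⊥ := by
  classical
  rw [ker_vecMulLinear_eq_comap_dualAnnihilator, ker_vecMulLinear_eq_comap_dualAnnihilator,
    Submodule.comap_equiv_eq_map_symm, Submodule.comap_equiv_eq_map_symm, ← Submodule.map_sup,
    ← Subspace.dualAnnihilator_inf_eq, Submodule.map_eq_top_iff,
    ← Submodule.dualAnnihilator_bot, Subspace.dualAnnihilator_inj]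

/-- For `X` uniformly distributed on `Fin m → F` (`F` a finite field) and matrices
`A : Matrix (Fin m) (Fin nA) F`, `B : Matrix (Fin m) (Fin nB) F`, the random
variables `Xᵀ A` and `Xᵀ B` are independent iff the column spans of `A` and `B`
intersect trivially. -/
theorem indep_vecMul_iff_spans_trivial_inter
    {F : Type*} [Field F] [Fintype F] {m nA nB : ℕ}
    (A : Matrix (Fin m) (Fin nA) F) (B : Matrix (Fin m) (Fin nB) F) :
    PMFIndepRV (PMF.uniformOfFintype (Fin m → F))
        (fun x => Matrix.vecMul x A) (fun x => Matrix.vecMul x B) ↔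
      LinearMap.range A.mulVecLin ⊓ LinearMap.range B.mulVecLin = ⊥ :=
  (pmfIndepRV_uniformOfFintype_iff_ker_sup_ker_eq_top A.vecMulLinear B.vecMulLinear).trans
    (Matrix.ker_vecMulLinear_sup_eq_top_iff A B)
end

section
/- (Achievability half of the capacity of linear computation broadcast, subspace form.) Let V be a finite-dimensional vector space over a field K and let A₁, A₁', A₂, A₂' be subspaces of V. Then there exists a valid broadcast subspace U (i.e., A₁ ≤ U ⊔ A₁' and A₂ ≤ U ⊔ A₂') with finrank U ≤ max(e₁, e₂). -/
open Module

namespace Submodule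

variable {K V : Type*} [Field K] [AddCommGroup V] [Module K V]

/-- A submodule that is contained in neither `X` nor `Y` is not contained in their union. -/
lemma exists_mem_notMem_notMem {W X Y : Submodule K V} (hX : ¬ W ≤ X) (hY : ¬ W ≤ Y) :
    ∃ w ∈ W, w ∉ X ∧ w ∉ Y := by
  obtain ⟨x, hxW, hx⟩ := SetLike.not_le_iff_exists.1 hX
  obtain ⟨y, hyW, hy⟩ := SetLike.not_le_iff_exists.1 hY
  by_cases hxY : x ∈ Y
  · by_cases hyX : y ∈ X
    · exact ⟨x + y, W.add_mem hxW hyW, fun h => hx ((X.add_mem_iff_left hyX).1 h),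
        fun h => hy ((Y.add_mem_iff_right hxY).1 h)⟩
    · exact ⟨y, hyW, hyX, hy⟩
  · exact ⟨x, hxW, hx, hxY⟩

lemma disjoint_sup_span_singleton {U X : Submodule K V} {w : V} (hUX : Disjoint U X)
    (hw : w ∉ U ⊔ X) : Disjoint (U ⊔ K ∙ w) X := by
  have hw' : Disjoint (U ⊔ X) (K ∙ w) :=
    disjoint_span_singleton_of_notMem hw
  exact (hUX.symm.disjoint_sup_right_of_disjoint_sup_left (by rwa [sup_comm X U])).symm

/-- Inside `W` there is a submodule disjoint from both `X` and `Y` that spans `W` modulo one of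
them. -/
lemma exists_le_disjoint_disjoint_le_sup [FiniteDimensional K V] (W X Y : Submodule K V) :
    ∃ U ≤ W, Disjoint U X ∧ Disjoint U Y ∧ (W ≤ U ⊔ X ∨ W ≤ U ⊔ Y) := by
  obtain ⟨U, ⟨hUW, hUX, hUY⟩, hmax⟩ := WellFounded.has_min
    (wellFounded_gt (α := Submodule K V)) {U | U ≤ W ∧ Disjoint U X ∧ Disjoint U Y}
    ⟨⊥, bot_le, disjoint_bot_left, disjoint_bot_left⟩
  refine ⟨U, hUW, hUX, hUY, ?_⟩
  by_contra! h
  obtain ⟨w, hwW, hwX, hwY⟩ := exists_mem_notMem_notMem h.1 h.2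
  refine hmax (U ⊔ K ∙ w) ⟨sup_le hUW ((span_singleton_le_iff_mem w W).2 hwW),
    disjoint_sup_span_singleton hUX hwX, disjoint_sup_span_singleton hUY hwY⟩ ?_
  refine lt_of_le_of_ne le_sup_left fun hU => hwX (mem_sup_left ?_)
  rw [hU]
  exact mem_sup_right (mem_span_singleton_self w)

lemma exists_sup_eq_finrank_add_eq [FiniteDimensional K V] {X P : Submodule K V} (h : X ≤ P) :
    ∃ C : Submodule K V, X ⊔ C = P ∧ finrank K X + finrank K C = finrank K P := by
  obtain ⟨C, hC⟩ := exists_isCompl X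
  have hsup : X ⊔ C ⊓ P = P := by rw [← sup_inf_assoc_of_le C h, hC.sup_eq_top, top_inf_eq]
  have hinf : X ⊓ (C ⊓ P) = ⊥ := (hC.disjoint.mono_right inf_le_left).eq_bot
  refine ⟨C ⊓ P, hsup, ?_⟩
  have := finrank_sup_add_finrank_inf_eq X (C ⊓ P)
  rw [hsup, hinf, finrank_bot] at this
  omega

/-- A submodule `U₀` of `P₁ ⊓ P₂` that is disjoint from `Q₁` and `Q₂` extends to a submodule `U`
spanning `P₁` modulo `Q₁` and `P₂` modulo `Q₂`, where `U₀` is counted only once. -/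
lemma exists_le_sup_le_sup_finrank_add_le [FiniteDimensional K V] {P₁ Q₁ P₂ Q₂ U₀ : Submodule K V}
    (h₁ : Q₁ ≤ P₁) (h₂ : Q₂ ≤ P₂) (hU₀ : U₀ ≤ P₁ ⊓ P₂) (hd₁ : Disjoint U₀ Q₁)
    (hd₂ : Disjoint U₀ Q₂) :
    ∃ U : Submodule K V, P₁ ≤ U ⊔ Q₁ ∧ P₂ ≤ U ⊔ Q₂ ∧
      finrank K U + finrank K U₀ + finrank K Q₁ + finrank K Q₂ ≤
        finrank K P₁ + finrank K P₂ := by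
  obtain ⟨C₁, hC₁, hr₁⟩ := exists_sup_eq_finrank_add_eq (sup_le (hU₀.trans inf_le_left) h₁)
  obtain ⟨C₂, hC₂, hr₂⟩ := exists_sup_eq_finrank_add_eq (sup_le (hU₀.trans inf_le_right) h₂)
  refine ⟨U₀ ⊔ C₁ ⊔ C₂, ?_, ?_, ?_⟩
  · rw [← hC₁, sup_right_comm]
    exact sup_le_sup_right le_sup_left Q₁
  · rw [← hC₂, sup_right_comm]
    exact sup_le_sup_right (sup_le_sup_right le_sup_left C₂) Q₂
  · have hs₁ := finrank_sup_add_finrank_inf_eq U₀ Q₁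
    have hs₂ := finrank_sup_add_finrank_inf_eq U₀ Q₂
    rw [hd₁.eq_bot, finrank_bot] at hs₁
    rw [hd₂.eq_bot, finrank_bot] at hs₂
    have := finrank_add_le_finrank_add_finrank (U₀ ⊔ C₁) C₂
    have := finrank_add_le_finrank_add_finrank U₀ C₁
    omega

/-- If `U₀ ≤ P₂` spans `P₁ ⊓ P₂` modulo `Q₁`, then its dimension is at least that of
`(P₁ ⊓ P₂) / (Q₁ ⊓ P₂)`. -/
lemma finrank_add_finrank_sup_le [FiniteDimensional K V] {P₁ Q₁ P₂ U₀ : Submodule K V}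
    (hU₀ : U₀ ≤ P₂) (h : P₁ ⊓ P₂ ≤ U₀ ⊔ Q₁) :
    finrank K P₁ + finrank K ↥(P₂ ⊔ Q₁) ≤
      finrank K ↥(P₁ ⊔ P₂) + finrank K U₀ + finrank K Q₁ := by
  have hW : P₁ ⊓ P₂ ≤ U₀ ⊔ Q₁ ⊓ P₂ := by
    rw [← sup_inf_assoc_of_le Q₁ hU₀]
    exact le_inf h inf_le_right
  have := finrank_mono hW
  have := finrank_add_le_finrank_add_finrank U₀ (Q₁ ⊓ P₂)
  have := finrank_sup_add_finrank_inf_eq P₁ P₂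
  have := finrank_sup_add_finrank_inf_eq Q₁ P₂
  rw [sup_comm P₂ Q₁]
  omega

end Submodule

/-- Achievability half of the capacity of linear computation broadcast, subspace
form: there is a valid broadcast subspace `U` (i.e. `A₁ ≤ U ⊔ A₁'` and
`A₂ ≤ U ⊔ A₂'`) of dimension at most `max e₁ e₂`. -/
theorem linear_computation_broadcast_achievability
    {K V : Type*} [Field K] [AddCommGroup V] [Module K V] [FiniteDimensional K V]
    (A₁ A₁' A₂ A₂' : Submodule K V) :
    ∃ U : Submodule K V, A₁ ≤ U ⊔ A₁' ∧ A₂ ≤ U ⊔ A₂' ∧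
      finrank K U ≤
        max ((finrank K ↥(A₁ ⊔ A₁') - finrank K ↥A₁') +
              (finrank K ↥(A₁ ⊔ A₂ ⊔ A₁' ⊔ A₂') - finrank K ↥(A₁ ⊔ A₁' ⊔ A₂')))
            ((finrank K ↥(A₂ ⊔ A₂') - finrank K ↥A₂') +
              (finrank K ↥(A₁ ⊔ A₂ ⊔ A₁' ⊔ A₂') - finrank K ↥(A₂ ⊔ A₂' ⊔ A₁'))) := by
  obtain ⟨U₀, hU₀, hd₁, hd₂, h⟩ :=
    Submodule.exists_le_disjoint_disjoint_le_sup ((A₁ ⊔ A₁') ⊓ (A₂ ⊔ A₂')) A₁' A₂'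
  obtain ⟨U, hU₁, hU₂, hU⟩ := Submodule.exists_le_sup_le_sup_finrank_add_le
    (le_sup_right : A₁' ≤ A₁ ⊔ A₁') (le_sup_right : A₂' ≤ A₂ ⊔ A₂') hU₀ hd₁ hd₂
  refine ⟨U, le_sup_left.trans hU₁, le_sup_left.trans hU₂, ?_⟩
  have hS : A₁ ⊔ A₂ ⊔ A₁' ⊔ A₂' = A₁ ⊔ A₁' ⊔ (A₂ ⊔ A₂') := by
    rw [sup_assoc (A₁ ⊔ A₂), sup_sup_sup_comm]
  rw [hS]
  rcases h with h | h
  · have := Submodule.finrank_add_finrank_sup_le (hU₀.trans inf_le_right) h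
    refine le_max_of_le_right ?_
    omega
  · rw [inf_comm] at h
    have := Submodule.finrank_add_finrank_sup_le (hU₀.trans inf_le_left) h
    rw [sup_comm (A₂ ⊔ A₂')] at this
    refine le_max_of_le_left ?_
    omega
end

section
/- (Converse half of the capacity of linear computation broadcast, subspace form.) Let V be a finite-dimensional vector space over a field K and let A₁, A₁', A₂, A₂' be subspaces of V. Then every valid broadcast subspace U (i.e., every subspace U with A₁ ≤ U ⊔ A₁' and A₂ ≤ U ⊔ A₂') satisfies finrank U ≥ max(e₁, e₂); equivalently, finrank U + finrank A₁' + finrank(A₁ ⊔ A₁' ⊔ A₂') ≥ finrank(A₁ ⊔ A₁') + finrank(A₁ ⊔ A₂ ⊔ A₁' ⊔ A₂') and finrank U + finrank A₂' + finrank(A₂ ⊔ A₂' ⊔ A₁') ≥ finrank(A₂ ⊔ A₂') + finrank(A₁ ⊔ A₂ ⊔ A₁' ⊔ A₂'). -/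
open Module

/-- Submodularity bound for one receiver of a linear computation broadcast. -/
theorem finrank_sup_add_finrank_sup_le_of_le_sup
    {K V : Type*} [Field K] [AddCommGroup V] [Module K V] [FiniteDimensional K V]
    {A A' B B' U : Submodule K V} (hA : A ≤ U ⊔ A') (hB : B ≤ U ⊔ B') :
    finrank K ↥(A ⊔ A') + finrank K ↥(A ⊔ B ⊔ A' ⊔ B') ≤
      finrank K U + finrank K ↥A' + finrank K ↥(A ⊔ A' ⊔ B') := by
  have hinf : A ⊔ A' ≤ (U ⊔ A') ⊓ (A ⊔ A' ⊔ B') :=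
    le_inf (sup_le hA le_sup_right) le_sup_left
  have hA'Y : A' ≤ A ⊔ A' ⊔ B' := le_sup_right.trans le_sup_left
  have hAY : A ≤ A ⊔ A' ⊔ B' := le_sup_left.trans le_sup_left
  have hsup : A ⊔ B ⊔ A' ⊔ B' ≤ (U ⊔ A') ⊔ (A ⊔ A' ⊔ B') :=
    sup_le (sup_le (sup_le (hAY.trans le_sup_right)
      (hB.trans (sup_le_sup le_sup_left le_sup_right)))
      (hA'Y.trans le_sup_right)) (le_sup_right.trans le_sup_right)
  have h₁ := Submodule.finrank_mono hinf
  have h₂ := Submodule.finrank_mono hsup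
  have h₃ := Submodule.finrank_sup_add_finrank_inf_eq (U ⊔ A') (A ⊔ A' ⊔ B')
  have h₄ := Submodule.finrank_add_le_finrank_add_finrank U A'
  lia

/-- Converse half of the capacity of linear computation broadcast, subspace form:
every valid broadcast subspace `U` (i.e. `A₁ ≤ U ⊔ A₁'` and `A₂ ≤ U ⊔ A₂'`)
satisfies `finrank U ≥ max e₁ e₂`; equivalently, the two subtraction-free
inequalities hold. -/
theorem linear_computation_broadcast_converse
    {K V : Type*} [Field K] [AddCommGroup V] [Module K V] [FiniteDimensional K V]
    (A₁ A₁' A₂ A₂' : Submodule K V) (U : Submodule K V)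
    (h₁ : A₁ ≤ U ⊔ A₁') (h₂ : A₂ ≤ U ⊔ A₂') :
    finrank K U ≥
        max ((finrank K ↥(A₁ ⊔ A₁') - finrank K ↥A₁') +
              (finrank K ↥(A₁ ⊔ A₂ ⊔ A₁' ⊔ A₂') - finrank K ↥(A₁ ⊔ A₁' ⊔ A₂')))
            ((finrank K ↥(A₂ ⊔ A₂') - finrank K ↥A₂') +
              (finrank K ↥(A₁ ⊔ A₂ ⊔ A₁' ⊔ A₂') - finrank K ↥(A₂ ⊔ A₂' ⊔ A₁'))) ∧
      finrank K U + finrank K ↥A₁' + finrank K ↥(A₁ ⊔ A₁' ⊔ A₂') ≥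
        finrank K ↥(A₁ ⊔ A₁') + finrank K ↥(A₁ ⊔ A₂ ⊔ A₁' ⊔ A₂') ∧
      finrank K U + finrank K ↥A₂' + finrank K ↥(A₂ ⊔ A₂' ⊔ A₁') ≥
        finrank K ↥(A₂ ⊔ A₂') + finrank K ↥(A₁ ⊔ A₂ ⊔ A₁' ⊔ A₂') := by
  have key₁ := finrank_sup_add_finrank_sup_le_of_le_sup h₁ h₂
  have key₂ := finrank_sup_add_finrank_sup_le_of_le_sup h₂ h₁
  have hcomm : A₂ ⊔ A₁ ⊔ A₂' ⊔ A₁' = A₁ ⊔ A₂ ⊔ A₁' ⊔ A₂' := by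
    rw [sup_comm A₂ A₁, sup_right_comm]
  rw [hcomm] at key₂
  have m₁ : finrank K ↥A₁' ≤ finrank K ↥(A₁ ⊔ A₁') := Submodule.finrank_mono le_sup_right
  have m₂ : finrank K ↥A₂' ≤ finrank K ↥(A₂ ⊔ A₂') := Submodule.finrank_mono le_sup_right
  have m₃ : finrank K ↥(A₁ ⊔ A₁' ⊔ A₂') ≤ finrank K ↥(A₁ ⊔ A₂ ⊔ A₁' ⊔ A₂') :=
    Submodule.finrank_mono (sup_le_sup_right (sup_le_sup_right le_sup_left _) _)
  have m₄ : finrank K ↥(A₂ ⊔ A₂' ⊔ A₁') ≤ finrank K ↥(A₁ ⊔ A₂ ⊔ A₁' ⊔ A₂') := by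
    rw [← hcomm]
    exact Submodule.finrank_mono (sup_le_sup_right (sup_le_sup_right le_sup_left _) _)
  refine ⟨max_le ?_ ?_, key₁, key₂⟩ <;> lia
end

section
/- (The identity n₁ᵦ = n₂ᵦ from the linear computation broadcast scheme.) Let V be a finite-dimensional vector space over a field K and let A, B, C be subspaces of V. Then finrank(A ⊓ (B ⊔ C)) + finrank(B ⊓ C) = finrank(B ⊓ (A ⊔ C)) + finrank(A ⊓ C). In particular, with A = span of the demand of user 1, B = span of the demand of user 2, and C = span of the combined side information, the dimensions of the mutually dependent parts of the two demands coincide. -/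
open Module

/-- The identity `n₁ᵦ = n₂ᵦ` from the linear computation broadcast scheme:
for subspaces `A, B, C` of a finite-dimensional vector space,
`dim(A ⊓ (B ⊔ C)) + dim(B ⊓ C) = dim(B ⊓ (A ⊔ C)) + dim(A ⊓ C)`. -/
theorem finrank_inf_sup_symm
    {K V : Type*} [Field K] [AddCommGroup V] [Module K V] [FiniteDimensional K V]
    (A B C : Submodule K V) :
    finrank K ↥(A ⊓ (B ⊔ C)) + finrank K ↥(B ⊓ C) =
      finrank K ↥(B ⊓ (A ⊔ C)) + finrank K ↥(A ⊓ C) := by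
  have hA := Submodule.finrank_sup_add_finrank_inf_eq A (B ⊔ C)
  have hB := Submodule.finrank_sup_add_finrank_inf_eq B (A ⊔ C)
  have hBC := Submodule.finrank_sup_add_finrank_inf_eq B C
  have hAC := Submodule.finrank_sup_add_finrank_inf_eq A C
  rw [sup_left_comm B A C] at hB
  omega
end

section
/- (Lemma: factorization of the permutation family on a regular •-set.) Let m₁ ≥ m₂ ≥ 1 and m ≥ 1 be natural numbers, and let π : ZMod m₁ → ZMod m₂ → Equiv.Perm (Fin m) be an arbitrary family of permutations. Then for every shift (z₁, z₂) ∈ ZMod m₁ × ZMod m₂ there exist families δ : ZMod m₁ → Equiv.Perm (Fin m) and γ : ZMod m₂ → Equiv.Perm (Fin m) such that γ y ∘ δ x = π x y for every (x, y) in the translated •-set B(z₁, z₂). -/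
/-- The translated •-set `B(z₁, z₂) ⊆ ZMod m₁ × ZMod m₂`: the translation by
`(z₁, z₂)` of the standard •-set
`B(0,0) = {(i, 0) : i} ∪ {(a, a+1) : a ∈ {0, …, m₂ − 2}}`. -/
def bulletSet (m₁ m₂ : ℕ) (z₁ : ZMod m₁) (z₂ : ZMod m₂) : Set (ZMod m₁ × ZMod m₂) :=
  (fun p : ZMod m₁ × ZMod m₂ => (p.1 + z₁, p.2 + z₂)) ''
    ({p : ZMod m₁ × ZMod m₂ | p.2 = 0} ∪
      {p : ZMod m₁ × ZMod m₂ |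
        ∃ a : ℕ, a + 1 < m₂ ∧ p.1 = (a : ZMod m₁) ∧ p.2 = ((a + 1 : ℕ) : ZMod m₂)})

/-- Factorization of an arbitrary permutation family on a regular (translated)
•-set: there are row permutations `δ` and column permutations `γ` with
`γ y ∘ δ x = π x y` (i.e. `γ y * δ x = π x y`) for every `(x, y)` in `B(z₁, z₂)`. -/
theorem perm_family_factorization_on_bulletSet
    {m₁ m₂ m : ℕ} (hm₂ : 1 ≤ m₂) (hm₁ : m₂ ≤ m₁) (hm : 1 ≤ m)
    (π : ZMod m₁ → ZMod m₂ → Equiv.Perm (Fin m))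
    (z₁ : ZMod m₁) (z₂ : ZMod m₂) :
    ∃ (δ : ZMod m₁ → Equiv.Perm (Fin m)) (γ : ZMod m₂ → Equiv.Perm (Fin m)),
      ∀ p ∈ bulletSet m₁ m₂ z₁ z₂, γ p.2 * δ p.1 = π p.1 p.2 := by
  refine ⟨fun x => π x z₂,
    fun y => π (((y - z₂).val - 1 : ℕ) + z₁) y * (π (((y - z₂).val - 1 : ℕ) + z₁) z₂)⁻¹, ?_⟩
  rintro _ ⟨⟨x, y⟩, hxy | ⟨a, ha, hx, hy⟩, rfl⟩
  · obtain rfl : y = 0 := hxy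
    simp
  · obtain rfl : x = (a : ZMod m₁) := hx
    obtain rfl : y = ((a + 1 : ℕ) : ZMod m₂) := hy
    simp only [add_sub_cancel_right, ZMod.val_cast_of_lt ha, Nat.add_sub_cancel,
      inv_mul_cancel_right]
end

section
/- (Lemma: distinctness and counting of acceptable regular •-sets.) Let m₁ ≥ m₂ ≥ 2 be natural numbers. Then (a) the map (z₁, z₂) ↦ B(z₁, z₂) from ZMod m₁ × ZMod m₂ to subsets of ZMod m₁ × ZMod m₂ is injective, so there are exactly m₁·m₂ translated •-sets; and (b) for every point (p, q) ∈ ZMod m₁ × ZMod m₂, the number of shifts (z₁, z₂) ∈ ZMod m₁ × ZMod m₂ with (p, q) ∈ B(z₁, z₂) equals m₁ + m₂ − 1. -/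
/-- A point lies in a translated •-set iff it lies in the full row of that set, or it is the
single point of the set in its own row. -/
theorem mem_bulletSet_iff {m₁ m₂ : ℕ} [NeZero m₂] {p : ZMod m₁ × ZMod m₂} {z₁ : ZMod m₁}
    {z₂ : ZMod m₂} :
    p ∈ bulletSet m₁ m₂ z₁ z₂ ↔
      z₂ = p.2 ∨ z₂ ≠ p.2 ∧ z₁ = p.1 - (((p.2 - z₂).val : ZMod m₁) - 1) := by
  obtain ⟨p₁, p₂⟩ := p
  simp only [bulletSet, Set.mem_image, Set.mem_union, Set.mem_ofPred_eq, Prod.exists, Prod.mk.injEq]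
  constructor
  · rintro ⟨x, y, hy | ⟨a, ha, hx, hy⟩, h₁, h₂⟩
    · left
      rw [← h₂, hy, zero_add]
    · right
      have hv : (p₂ - z₂).val = a + 1 := by
        rw [← h₂, add_sub_cancel_right, hy, ZMod.val_natCast_of_lt ha]
      refine ⟨fun h => ?_, ?_⟩
      · rw [h, sub_self, ZMod.val_zero] at hv
        omega
      · rw [hv, ← h₁, hx]
        push_cast
        ring
  · rintro (h | ⟨h, h₁⟩)
    · exact ⟨p₁ - z₁, 0, Or.inl rfl, by ring, by rw [h, zero_add]⟩
    · have hpos : (p₂ - z₂).val ≠ 0 := by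
        rw [Ne, ZMod.val_eq_zero, sub_eq_zero]
        exact Ne.symm h
      have hlt := ZMod.val_lt (p₂ - z₂)
      obtain ⟨a, ha⟩ := Nat.exists_eq_succ_of_ne_zero hpos
      rw [Nat.succ_eq_add_one] at ha
      refine ⟨p₁ - z₁, p₂ - z₂, Or.inr ⟨a, ha ▸ hlt, ?_, ?_⟩, by ring, by ring⟩
      · rw [h₁, ha]
        push_cast
        ring
      · rw [← ha, ZMod.natCast_zmod_val]

theorem bulletSet_injective {m₁ m₂ : ℕ} (hm₁ : 2 ≤ m₁) (hm₂ : 2 ≤ m₂) :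
    Function.Injective fun z : ZMod m₁ × ZMod m₂ => bulletSet m₁ m₂ z.1 z.2 := by
  have : Fact (1 < m₁) := ⟨hm₁⟩
  have : Fact (1 < m₂) := ⟨hm₂⟩
  have : NeZero m₂ := ⟨by omega⟩
  rintro ⟨z₁, z₂⟩ ⟨w₁, w₂⟩ h
  have hmem (p : ZMod m₁ × ZMod m₂) (hp : p ∈ bulletSet m₁ m₂ z₁ z₂) :
      p ∈ bulletSet m₁ m₂ w₁ w₂ := (Set.ext_iff.mp h p).mp hp
  have h₂ : w₂ = z₂ := by
    by_contra hne
    have hrow (x : ZMod m₁) : w₁ = x - (((z₂ - w₂).val : ZMod m₁) - 1) :=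
      ((mem_bulletSet_iff.mp (hmem (x, z₂) (mem_bulletSet_iff.mpr (Or.inl rfl)))).resolve_left
        hne).2
    exact zero_ne_one (sub_left_injective ((hrow 0).symm.trans (hrow 1)))
  subst h₂
  have hne : w₂ ≠ w₂ + 1 := by simp
  have hp := hmem (z₁, w₂ + 1) (mem_bulletSet_iff.mpr (Or.inr ⟨hne, by simp [ZMod.val_one]⟩))
  have h₁ : w₁ = z₁ := by
    simpa [ZMod.val_one] using ((mem_bulletSet_iff.mp hp).resolve_left hne).2
  rw [h₁]

theorem ncard_shifts_mem_bulletSet {m₁ m₂ : ℕ} [NeZero m₁] [NeZero m₂]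
    (p : ZMod m₁ × ZMod m₂) :
    Set.ncard {z : ZMod m₁ × ZMod m₂ | p ∈ bulletSet m₁ m₂ z.1 z.2} = m₁ + m₂ - 1 := by
  have hset : {z : ZMod m₁ × ZMod m₂ | p ∈ bulletSet m₁ m₂ z.1 z.2} =
      (fun x => (x, p.2)) '' Set.univ ∪
        (fun y => (p.1 - (((p.2 - y).val : ZMod m₁) - 1), y)) '' {p.2}ᶜ := by
    ext ⟨z₁, z₂⟩
    simp only [Set.mem_ofPred_eq, mem_bulletSet_iff, Set.mem_union, Set.mem_image, Set.mem_univ,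
      Set.mem_compl_iff, Set.mem_singleton_iff, Prod.mk.injEq]
    grind
  rw [hset, Set.ncard_union_eq, Set.ncard_image_of_injective, Set.ncard_image_of_injective,
    Set.ncard_univ, Set.ncard_compl, Set.ncard_singleton, Nat.card_zmod, Nat.card_zmod]
  · have := NeZero.pos m₂
    omega
  · exact fun _ _ h => congrArg Prod.snd h
  · exact fun _ _ h => congrArg Prod.fst h
  · rw [Set.disjoint_left]
    rintro _ ⟨x, -, rfl⟩ ⟨y, hy, h⟩
    exact hy (congrArg Prod.snd h)

/-- Distinctness and counting of acceptable regular •-sets: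
(a) distinct shifts give distinct translated •-sets, so there are exactly `m₁ m₂`
of them; and (b) every point `(p, q)` lies in exactly `m₁ + m₂ − 1` of the
translated •-sets. -/
theorem bulletSet_injective_and_count
    {m₁ m₂ : ℕ} (hm₂ : 2 ≤ m₂) (hm₁ : m₂ ≤ m₁) :
    (Function.Injective fun z : ZMod m₁ × ZMod m₂ => bulletSet m₁ m₂ z.1 z.2) ∧
      Set.ncard (Set.range fun z : ZMod m₁ × ZMod m₂ => bulletSet m₁ m₂ z.1 z.2) =
        m₁ * m₂ ∧
      ∀ p : ZMod m₁ × ZMod m₂,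
        Set.ncard {z : ZMod m₁ × ZMod m₂ | p ∈ bulletSet m₁ m₂ z.1 z.2} =
          m₁ + m₂ - 1 := by
  have : NeZero m₁ := ⟨by omega⟩
  have : NeZero m₂ := ⟨by omega⟩
  have hinj := bulletSet_injective (hm₂.trans hm₁) hm₂
  refine ⟨hinj, ?_, ncard_shifts_mem_bulletSet⟩
  rw [← Set.image_univ, Set.ncard_image_of_injective _ hinj, Set.ncard_univ, Nat.card_prod,
    Nat.card_zmod, Nat.card_zmod]
end

section
/- (Lemma: the induced permutation of a consistent cycle has a fixed point.) Let α, β, γ be types, let π : α → β → Equiv.Perm γ, let k ≥ 2, and let a : Fin k → α, b : Fin k → β (with index arithmetic i+1 cyclic in Fin k). Suppose there exist f : α → γ and g : β → γ such that for every i ∈ Fin k both g (b i) = π (a i) (b i) (f (a i)) and g (b i) = π (a (i+1)) (b i) (f (a (i+1))). Then the induced permutation σ = σ_{k−1} ∘ ⋯ ∘ σ₁ ∘ σ₀, where σᵢ = (π (a (i+1)) (b i))⁻¹ ∘ (π (a i) (b i)), satisfies σ (f (a 0)) = f (a 0); in particular σ is not a derangement (assuming γ is such that f (a 0) exists). -/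
/-- The induced permutation `σ = σ_{k−1} ∘ ⋯ ∘ σ₁ ∘ σ₀` of a cycle described by
`a : Fin k → α`, `b : Fin k → β` (index arithmetic cyclic in `Fin k`), where
`σᵢ = (π (a (i+1)) (b i))⁻¹ ∘ (π (a i) (b i))`. -/
def inducedPerm {α β γ : Type*} (π : α → β → Equiv.Perm γ) {k : ℕ} [NeZero k]
    (a : Fin k → α) (b : Fin k → β) : Equiv.Perm γ :=
  ((List.ofFn fun i : Fin k => (π (a (i + 1)) (b i))⁻¹ * π (a i) (b i)).reverse).prod

/-- Composing `σ 0`, …, `σ (n - 1)` in this order carries `x 0` to `x n`, provided that each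
`σ i` carries `x i` to `x (i + 1)`. -/
theorem prod_reverse_ofFn_apply {γ : Type*} {n : ℕ} (σ : Fin n → Equiv.Perm γ) (x : ℕ → γ)
    (h : ∀ i : Fin n, σ i (x i) = x (i + 1)) :
    (List.ofFn σ).reverse.prod (x 0) = x n := by
  induction n generalizing x with
  | zero => simp
  | succ n ih =>
    have h_zero : σ 0 (x 0) = x 1 := h 0
    rw [List.ofFn_succ, List.reverse_cons, List.prod_append, List.prod_singleton,
      Equiv.Perm.mul_apply, h_zero]
    exact ih (fun i => σ i.succ) (fun j => x (j + 1)) fun i => h i.succ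

/-- If the cycle `(a, b)` is consistent with decoding functions `f`, `g` (i.e.
`g (b i) = π (a i) (b i) (f (a i))` and `g (b i) = π (a (i+1)) (b i) (f (a (i+1)))`
for all `i`), then the induced permutation fixes `f (a 0)`; in particular it is
not a derangement. -/
theorem inducedPerm_fixes_of_consistent
    {α β γ : Type*} (π : α → β → Equiv.Perm γ) {k : ℕ} [NeZero k] (hk : 2 ≤ k)
    (a : Fin k → α) (b : Fin k → β) (f : α → γ) (g : β → γ)
    (h₁ : ∀ i : Fin k, g (b i) = π (a i) (b i) (f (a i)))
    (h₂ : ∀ i : Fin k, g (b i) = π (a (i + 1)) (b i) (f (a (i + 1)))) :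
    inducedPerm π a b (f (a 0)) = f (a 0) := by
  have h_step := prod_reverse_ofFn_apply
    (fun i : Fin k => (π (a (i + 1)) (b i))⁻¹ * π (a i) (b i))
    (fun j => f (a (Fin.ofNat k j))) fun i => by
      have h_cast : Fin.ofNat k i = i := Fin.ofNat_val_eq_self i
      have h_succ : Fin.ofNat k (i + 1) = i + 1 := by
        ext
        simp [Fin.val_add]
      rw [h_cast, h_succ, Equiv.Perm.mul_apply, ← h₁, h₂]
      exact Equiv.symm_apply_apply _ _
  have h_zero : Fin.ofNat k 0 = 0 := rfl
  have h_last : Fin.ofNat k k = 0 := by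
    ext
    simp
  simpa only [inducedPerm, h_zero, h_last] using h_step
end

section
/- (Factorization of maximally structured permutation families.) Let α and β be nonempty types, γ any type, and π : α → β → Equiv.Perm γ. Suppose every length-4 cycle induces the identity, i.e., for all a, a' ∈ α and b, b' ∈ β, (π a' b') ∘ (π a' b)⁻¹ ∘ (π a b) ∘ (π a b')⁻¹ is the identity permutation. Then there exist families δ : α → Equiv.Perm γ and Γ : β → Equiv.Perm γ such that π a b = Γ b ∘ δ a for all a ∈ α and b ∈ β. -/
/-- Factorization of maximally structured permutation families: if every
length-4 cycle induces the identity permutation, i.e.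
`π a' b' ∘ (π a' b)⁻¹ ∘ π a b ∘ (π a b')⁻¹ = id` for all `a, a', b, b'`, then `π`
splits as `π a b = Γ b ∘ δ a` for some row family `δ` and column family `Γ`. -/
theorem maximally_structured_factorization
    {α β γ : Type*} [Nonempty α] [Nonempty β]
    (π : α → β → Equiv.Perm γ)
    (hmax : ∀ (a a' : α) (b b' : β),
      π a' b' * (π a' b)⁻¹ * π a b * (π a b')⁻¹ = 1) :
    ∃ (δ : α → Equiv.Perm γ) (Γ : β → Equiv.Perm γ),
      ∀ (a : α) (b : β), π a b = Γ b * δ a := by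
  obtain ⟨a₀⟩ := ‹Nonempty α›
  obtain ⟨b₀⟩ := ‹Nonempty β›
  refine ⟨fun a => (π a₀ b₀)⁻¹ * π a b₀, fun b => π a₀ b, fun a b => ?_⟩
  rw [← mul_assoc]
  exact (mul_inv_eq_one.mp (hmax a a₀ b₀ b)).symm
end
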